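/- Suppose n ≤ m(1 − 1/k) and that conditions (1.4) and (1.5) hold. Then every global weak solution u of the problem ∂_t^k u − Σ_{|α|=m} ∂^α a_α(x,t,u) ≥ f(|u|) in ℝ^{n+1}_+ with initial data ∂_t^i u(·,0) = u_i (0 ≤ i ≤ k−1) is trivial, i.e. u = 0 almost everywhere in ℝ^{n+1}_+. -/

import Mathlib

open MeasureTheory Real Set Filter

noncomputable section

/-- The spatial domain `ℝⁿ`. -/
abbrev Spc (n : ℕ) := EuclideanSpace ℝ (Fin n)

/-- The open ball `B_r` in `ℝⁿ` of radius `r` centered at `0`. -/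
def ball0 (n : ℕ) (r : ℝ) : Set (Spc n) := Metric.ball 0 r

/-- The cylinder `Q_r^κ = B_r × (0, r^κ)`. -/
def cyl (n : ℕ) (r κ : ℝ) : Set (Spc n × ℝ) := ball0 n r ×ˢ Ioo 0 (r ^ κ)

/-- The half-space `ℝ^{n+1}_+ = ℝⁿ × (0, ∞)`. -/
def halfSp (n : ℕ) : Set (Spc n × ℝ) := {z | 0 < z.2}

/-- The (finite) set of multi-indices `α` with `|α| = m`. -/
def mIdx (n m : ℕ) : Finset (Fin n → ℕ) :=
  (Fintype.piFinset fun _ : Fin n => Finset.range (m + 1)).filter fun α => ∑ i, α i = m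

/-- Spatial partial derivative `∂/∂x_i`. -/
def spDeriv (n : ℕ) (i : Fin n) (φ : Spc n × ℝ → ℝ) : Spc n × ℝ → ℝ :=
  fun z => deriv (fun s : ℝ => φ (z.1 + s • EuclideanSpace.single i (1 : ℝ), z.2)) 0

/-- Time derivative `∂/∂t`. -/
def tDeriv (n : ℕ) (φ : Spc n × ℝ → ℝ) : Spc n × ℝ → ℝ :=
  fun z => deriv (fun s : ℝ => φ (z.1, s)) z.2

/-- Multi-index spatial derivative `∂^α`. -/
def mDeriv (n : ℕ) (α : Fin n → ℕ) (φ : Spc n × ℝ → ℝ) : Spc n × ℝ → ℝ :=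
  (List.finRange n).foldr (fun i ψ => (spDeriv n i)^[α i] ψ) φ

/-- Caratheodory conditions and the growth bound `|a_α(x,t,ζ)| ≤ A |ζ|^p` for the
coefficients of the operator `L`. -/
def GoodCoeffs (n m : ℕ) (A p : ℝ) (a : (Fin n → ℕ) → Spc n × ℝ → ℝ → ℝ) : Prop :=
  ∀ α ∈ mIdx n m,
    (∀ ζ : ℝ, Measurable fun z => a α z ζ) ∧
    (∀ᵐ z ∂(volume.restrict (halfSp n)), Continuous fun ζ => a α z ζ) ∧
    (∀ᵐ z ∂(volume.restrict (halfSp n)), ∀ ζ : ℝ, |a α z ζ| ≤ A * |ζ| ^ p)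

/-- The standing conditions on `f`: `ζ ↦ f ζ` and `ζ ↦ f (ζ^{1/p})` are nondecreasing
and convex on `[0,∞)`, and `f` is positive on `(0,∞)`. -/
def GoodF (p : ℝ) (f : ℝ → ℝ) : Prop :=
  MonotoneOn f (Ici 0) ∧ ConvexOn ℝ (Ici 0) f ∧
  MonotoneOn (fun ζ => f (ζ ^ (1 / p))) (Ici 0) ∧
  ConvexOn ℝ (Ici 0) (fun ζ => f (ζ ^ (1 / p))) ∧
  ∀ ζ : ℝ, 0 < ζ → 0 < f ζ

/-- Condition (1.4): `∫_1^∞ ζ^{1/k - 1} f(ζ)^{-1/k} dζ < ∞`. -/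
def Cond14 (k : ℕ) (f : ℝ → ℝ) : Prop :=
  IntegrableOn (fun ζ : ℝ => ζ ^ ((k : ℝ)⁻¹ - 1) / f ζ ^ ((k : ℝ)⁻¹)) (Ioi 1)

/-- Condition (1.5): `∫_1^∞ ζ^{p/m - 1} f(ζ)^{-1/m} dζ < ∞`. -/
def Cond15 (m : ℕ) (p : ℝ) (f : ℝ → ℝ) : Prop :=
  IntegrableOn (fun ζ : ℝ => ζ ^ (p / (m : ℝ) - 1) / f ζ ^ ((m : ℝ)⁻¹)) (Ioi 1)

/-- `v ∈ L^1_loc(ℝⁿ)`. -/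
def L1locInit (n : ℕ) (v : Spc n → ℝ) : Prop :=
  ∀ r : ℝ, 0 < r → IntegrableOn v (ball0 n r)

/-- `u` is a global weak solution of
`∂_t^k u - Σ_{|α| = m} ∂^α a_α(x,t,u) ≥ f(|u|)` in `ℝ^{n+1}_+`, with initial data
`∂_t^i u(·,0) = u0 i` for `0 ≤ i ≤ k-1`. -/
def IsGlobalWeakSol (n k m : ℕ) (p : ℝ) (a : (Fin n → ℕ) → Spc n × ℝ → ℝ → ℝ)
    (f : ℝ → ℝ) (u0 : ℕ → Spc n → ℝ) (u : Spc n × ℝ → ℝ) : Prop :=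
  (∀ r : ℝ, 0 < r → IntegrableOn u (cyl n r 1)) ∧
  (∀ r : ℝ, 0 < r → IntegrableOn (fun z => |u z| ^ p) (cyl n r 1)) ∧
  (∀ r : ℝ, 0 < r → IntegrableOn (fun z => f |u z|) (cyl n r 1)) ∧
  ∀ φ : Spc n × ℝ → ℝ, ContDiff ℝ (⊤ : ℕ∞) φ → HasCompactSupport φ →
    (∀ z, 0 ≤ φ z) →
    (∫ z in halfSp n, (-1 : ℝ) ^ k * u z * (tDeriv n)^[k] φ z)
      - (∫ z in halfSp n, ∑ α ∈ mIdx n m, (-1 : ℝ) ^ m * a α z (u z) * mDeriv n α φ z)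
    ≥ (∫ x : Spc n, ∑ i ∈ Finset.range k,
          (-1 : ℝ) ^ i * u0 (k - 1 - i) x * (tDeriv n)^[i] φ (x, 0))
      + ∫ z in halfSp n, f |u z| * φ z

/-- `u = 0` almost everywhere in `ℝ^{n+1}_+`. -/
def TrivialSol (n : ℕ) (u : Spc n × ℝ → ℝ) : Prop :=
  ∀ᵐ z ∂(volume.restrict (halfSp n)), u z = 0


theorem smoothTransition_iteratedDeriv_bounded (j : ℕ) :
    ∃ C : ℝ, 0 < C ∧ ∀ x, |iteratedDeriv j smoothTransition x| ≤ C := by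
  have hc : Continuous (iteratedDeriv j smoothTransition) :=
    (smoothTransition.contDiff (n := (⊤ : ℕ∞))).continuous_iteratedDeriv j (mod_cast le_top)
  obtain ⟨B, hB⟩ := (isCompact_Icc (a := (0 : ℝ)) (b := 1)).exists_bound_of_continuousOn
    hc.continuousOn
  refine ⟨max B 1, by positivity, fun x => ?_⟩
  rcases lt_or_ge x 0 with h0 | h0
  · have he : smoothTransition =ᶠ[nhds x] fun _ => (0 : ℝ) := by
      filter_upwards [Iio_mem_nhds h0] with y hy
      exact smoothTransition.zero_of_nonpos (le_of_lt hy)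
    rw [he.iteratedDeriv_eq, iteratedDeriv_const]
    split_ifs <;> simp
  rcases le_or_gt x 1 with h1 | h1
  · exact (hB x ⟨h0, h1⟩).trans (le_max_left _ _)
  · have he : smoothTransition =ᶠ[nhds x] fun _ => (1 : ℝ) := by
      filter_upwards [Ioi_mem_nhds h1] with y hy
      exact smoothTransition.one_of_one_le (le_of_lt hy)
    rw [he.iteratedDeriv_eq, iteratedDeriv_const]
    split_ifs <;> simp

/-- `η` is a smooth cutoff equal to `1` on `[-a, a]` and to `0` off `(-b, b)` whose derivative of
order `j` is at most `C j / (b - a) ^ j`. -/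
structure IsCutoff (C : ℕ → ℝ) (a b : ℝ) (η : ℝ → ℝ) : Prop where
  contDiff : ContDiff ℝ (⊤ : ℕ∞) η
  nonneg : ∀ x, 0 ≤ η x
  le_one : ∀ x, η x ≤ 1
  eq_one : ∀ x, |x| ≤ a → η x = 1
  eq_zero : ∀ x, b ≤ |x| → η x = 0
  bound : ∀ j x, |iteratedDeriv j η x| ≤ C j / (b - a) ^ j

theorem IsCutoff.iteratedDeriv_eq_zero {C : ℕ → ℝ} {a b : ℝ} {η : ℝ → ℝ} (h : IsCutoff C a b η)
    (j : ℕ) {x : ℝ} (hx : b < |x|) : iteratedDeriv j η x = 0 := by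
  have he : η =ᶠ[nhds x] fun _ => (0 : ℝ) := by
    filter_upwards [continuous_abs.continuousAt.eventually (Ioi_mem_nhds hx)] with y hy
    exact h.eq_zero y (le_of_lt hy)
  rw [he.iteratedDeriv_eq, iteratedDeriv_const]
  simp

theorem IsCutoff.iteratedDeriv_zero {C : ℕ → ℝ} {a b : ℝ} {η : ℝ → ℝ} (h : IsCutoff C a b η)
    (ha : 0 < a) {j : ℕ} (hj : j ≠ 0) : iteratedDeriv j η 0 = 0 := by
  have he : η =ᶠ[nhds 0] fun _ => (1 : ℝ) := by
    have h0 : |(0 : ℝ)| < a := by simpa using ha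
    filter_upwards [continuous_abs.continuousAt.eventually (Iio_mem_nhds h0)] with y hy
    exact h.eq_one y (le_of_lt hy)
  rw [he.iteratedDeriv_eq, iteratedDeriv_const]
  simp [hj]

theorem exists_isCutoff : ∃ C : ℕ → ℝ, (∀ j, 0 < C j) ∧
    ∀ a b : ℝ, 0 < a → a < b → ∃ η, IsCutoff C a b η := by
  choose C hC0 hC using smoothTransition_iteratedDeriv_bounded
  refine ⟨C, hC0, fun a b ha hab => ?_⟩
  set c := (b - a)⁻¹ with hc
  have hba : 0 < b - a := sub_pos.2 hab
  have hc0 : 0 < c := inv_pos.2 hba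
  have hcm : c * (b - a) = 1 := inv_mul_cancel₀ hba.ne'
  have hG : ContDiff ℝ (⊤ : ℕ∞) smoothTransition := smoothTransition.contDiff
  have one_of : ∀ y, b - a ≤ y → smoothTransition (c * y) = 1 := fun y hy =>
    smoothTransition.one_of_one_le (by rw [← hcm]; gcongr)
  have zero_of : ∀ y, y ≤ 0 → smoothTransition (c * y) = 0 := fun y hy =>
    smoothTransition.zero_of_nonpos (mul_nonpos_of_nonneg_of_nonpos hc0.le hy)
  have hscale : ∀ j : ℕ, iteratedDeriv j (fun y => smoothTransition (c * y)) =
      fun y => c ^ j * iteratedDeriv j smoothTransition (c * y) := fun j =>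
    iteratedDeriv_comp_const_mul (smoothTransition.contDiff (n := (j : ℕ∞))) c
  obtain ⟨F, hF⟩ : ∃ F : ℝ → ℝ, F = fun y => smoothTransition (c * y) := ⟨_, rfl⟩
  have hbd : ∀ j y, |iteratedDeriv j F y| ≤ C j / (b - a) ^ j := by
    intro j y
    rw [hF, hscale, abs_mul, abs_of_pos (pow_pos hc0 j), div_eq_inv_mul, ← inv_pow]
    exact mul_le_mul_of_nonneg_left (hC j _) (pow_pos hc0 j).le
  refine ⟨fun x => smoothTransition (c * (b - x)) * smoothTransition (c * (b + x)), ?_, ?_, ?_,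
    ?_, ?_, ?_⟩
  · exact (hG.comp (by fun_prop)).mul (hG.comp (by fun_prop))
  · exact fun x => mul_nonneg (smoothTransition.nonneg _) (smoothTransition.nonneg _)
  · exact fun x => mul_le_one₀ (smoothTransition.le_one _) (smoothTransition.nonneg _)
      (smoothTransition.le_one _)
  · intro x hx
    have := abs_le.1 hx
    rw [one_of _ (by linarith), one_of _ (by linarith), mul_one]
  · intro x hx
    rcases le_abs.1 hx with h | h
    · rw [zero_of (b - x) (by linarith), zero_mul]
    · rw [zero_of (b + x) (by linarith), mul_zero]
  · intro j x
    rcases lt_or_ge (-a) x with h | h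
    · have he : (fun x => smoothTransition (c * (b - x)) * smoothTransition (c * (b + x)))
          =ᶠ[nhds x] fun x => F (b - x) := by
        filter_upwards [Ioi_mem_nhds h] with y hy
        rw [one_of (b + y) (by linarith [mem_Ioi.1 hy]), mul_one, hF]
      rw [he.iteratedDeriv_eq, iteratedDeriv_comp_const_sub]
      simpa [abs_mul] using hbd j (b - x)
    · have he : (fun x => smoothTransition (c * (b - x)) * smoothTransition (c * (b + x)))
          =ᶠ[nhds x] fun x => F (b + x) := by
        filter_upwards [Iio_mem_nhds (show x < a by linarith)] with y hy
        rw [one_of (b - y) (by linarith [mem_Iio.1 hy]), one_mul, hF]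
      rw [he.iteratedDeriv_eq, iteratedDeriv_comp_const_add]
      exact hbd j (b + x)

/-- The function `(x, t) ↦ ∏ i, g i (x i) * h t`. -/
def tensorFun {n : ℕ} (g : Fin n → ℝ → ℝ) (h : ℝ → ℝ) : Spc n × ℝ → ℝ :=
  fun z => (∏ i, g i (z.1 i)) * h z.2

theorem spDeriv_tensorFun {n : ℕ} (i : Fin n) (g : Fin n → ℝ → ℝ) (h : ℝ → ℝ) :
    spDeriv n i (tensorFun g h) = tensorFun (Function.update g i (deriv (g i))) h := by
  funext z
  have hfun : (fun s : ℝ => tensorFun g h (z.1 + s • EuclideanSpace.single i (1 : ℝ), z.2)) =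
      fun s => ((∏ j ∈ Finset.univ.erase i, g j (z.1 j)) * h z.2) * g i (z.1 i + s) := by
    funext s
    simp only [tensorFun]
    rw [← Finset.mul_prod_erase Finset.univ _ (Finset.mem_univ i)]
    have : ∏ j ∈ Finset.univ.erase i,
        g j ((z.1 + s • EuclideanSpace.single i (1 : ℝ)) j) =
        ∏ j ∈ Finset.univ.erase i, g j (z.1 j) := by
      refine Finset.prod_congr rfl fun j hj => ?_
      have hji : j ≠ i := Finset.ne_of_mem_erase hj
      simp [hji]
    rw [this]
    simp
    ring
  simp only [spDeriv]
  rw [hfun, deriv_const_mul_field, deriv_comp_const_add, tensorFun,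
    ← Finset.mul_prod_erase Finset.univ _ (Finset.mem_univ i)]
  have : ∏ j ∈ Finset.univ.erase i, Function.update g i (deriv (g i)) j (z.1 j) =
      ∏ j ∈ Finset.univ.erase i, g j (z.1 j) := by
    refine Finset.prod_congr rfl fun j hj => ?_
    rw [Function.update_of_ne (Finset.ne_of_mem_erase hj)]
  rw [this]
  simp
  ring

theorem spDeriv_iterate_tensorFun {n : ℕ} (i : Fin n) (j : ℕ) (g : Fin n → ℝ → ℝ) (h : ℝ → ℝ) :
    (spDeriv n i)^[j] (tensorFun g h) =
      tensorFun (Function.update g i (iteratedDeriv j (g i))) h := by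
  induction j with
  | zero => simp
  | succ j ih =>
    rw [Function.iterate_succ_apply', ih, spDeriv_tensorFun]
    simp [iteratedDeriv_succ]

theorem tDeriv_iterate_tensorFun {n : ℕ} (j : ℕ) (g : Fin n → ℝ → ℝ) (h : ℝ → ℝ) :
    (tDeriv n)^[j] (tensorFun g h) = tensorFun g (iteratedDeriv j h) := by
  induction j with
  | zero => simp
  | succ j ih =>
    rw [Function.iterate_succ_apply', ih]
    funext z
    simp only [tDeriv, tensorFun]
    rw [deriv_const_mul_field, iteratedDeriv_succ]

theorem mDeriv_tensorFun {n : ℕ} (α : Fin n → ℕ) (g : Fin n → ℝ → ℝ) (h : ℝ → ℝ) :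
    mDeriv n α (tensorFun g h) = tensorFun (fun i => iteratedDeriv (α i) (g i)) h := by
  have key : ∀ l : List (Fin n), l.Nodup →
      l.foldr (fun i ψ => (spDeriv n i)^[α i] ψ) (tensorFun g h) =
        tensorFun (fun i => if i ∈ l then iteratedDeriv (α i) (g i) else g i) h := by
    intro l
    induction l with
    | nil => simp
    | cons i l ih =>
      intro hl
      rw [List.nodup_cons] at hl
      rw [List.foldr_cons, ih hl.2, spDeriv_iterate_tensorFun]
      congr 1
      funext j
      by_cases hj : j = i
      · subst hj
        simp [hl.1]
      · simp [hj]
  rw [mDeriv, key _ (List.nodup_finRange n)]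
  simp

theorem EuclideanSpace.norm_le_of_abs_le {n : ℕ} {x : Spc n} {b : ℝ} (hb : 0 ≤ b)
    (h : ∀ i, |x i| ≤ b) : ‖x‖ ≤ n * b := by
  rw [EuclideanSpace.norm_eq]
  refine Real.sqrt_le_iff.2 ⟨by positivity, ?_⟩
  calc ∑ i, ‖x i‖ ^ 2 ≤ ∑ _i : Fin n, b ^ 2 :=
        Finset.sum_le_sum fun i _ => pow_le_pow_left₀ (norm_nonneg _) (h i) 2
    _ = n * b ^ 2 := by simp
    _ ≤ (n : ℝ) ^ 2 * b ^ 2 := by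
        gcongr
        exact_mod_cast Nat.le_self_pow two_ne_zero n
    _ = (n * b) ^ 2 := by ring

theorem contDiff_tensorFun {n : ℕ} {g : Fin n → ℝ → ℝ} {h : ℝ → ℝ}
    (hg : ∀ i, ContDiff ℝ (⊤ : ℕ∞) (g i)) (hh : ContDiff ℝ (⊤ : ℕ∞) h) :
    ContDiff ℝ (⊤ : ℕ∞) (tensorFun g h) := by
  refine ContDiff.mul (contDiff_prod fun i _ => (hg i).comp ?_) (hh.comp contDiff_snd)
  exact (EuclideanSpace.proj (𝕜 := ℝ) i).contDiff.comp contDiff_fst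

/-- The space-time box `[-ρ, ρ]ⁿ × (0, τ]`. -/
def box (n : ℕ) (ρ τ : ℝ) : Set (Spc n × ℝ) := {x | ∀ i, |x i| ≤ ρ} ×ˢ Ioc 0 τ

theorem measurableSet_cube (n : ℕ) (ρ : ℝ) : MeasurableSet {x : Spc n | ∀ i, |x i| ≤ ρ} := by
  have : {x : Spc n | ∀ i, |x i| ≤ ρ} = ⋂ i, {x : Spc n | |x i| ≤ ρ} := by ext; simp
  rw [this]
  exact MeasurableSet.iInter fun i => measurableSet_le (by fun_prop) measurable_const

theorem measurableSet_box (n : ℕ) (ρ τ : ℝ) : MeasurableSet (box n ρ τ) :=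
  (measurableSet_cube n ρ).prod measurableSet_Ioc

theorem measurableSet_halfSp (n : ℕ) : MeasurableSet (halfSp n) :=
  measurableSet_lt measurable_const measurable_snd

theorem box_subset_halfSp (n : ℕ) (ρ τ : ℝ) : box n ρ τ ⊆ halfSp n := fun _ hz => hz.2.1

theorem box_mono (n : ℕ) {ρ ρ' τ τ' : ℝ} (hρ : ρ ≤ ρ') (hτ : τ ≤ τ') :
    box n ρ τ ⊆ box n ρ' τ' :=
  fun _ hz => ⟨fun i => (hz.1 i).trans hρ, hz.2.1, hz.2.2.trans hτ⟩

theorem box_subset_cyl (n : ℕ) (ρ τ : ℝ) : ∃ r : ℝ, 0 < r ∧ box n ρ τ ⊆ cyl n r 1 := by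
  refine ⟨n * |ρ| + |τ| + 1, by positivity, fun z hz => ⟨?_, hz.2.1, ?_⟩⟩
  · rw [ball0, mem_ball_zero_iff]
    have := EuclideanSpace.norm_le_of_abs_le (abs_nonneg ρ)
      fun i => (hz.1 i).trans (le_abs_self ρ)
    linarith [abs_nonneg τ]
  · rw [rpow_one]
    have : 0 ≤ n * |ρ| := by positivity
    linarith [hz.2.2, le_abs_self τ]

theorem volume_box (n : ℕ) {ρ : ℝ} (hρ : 0 ≤ ρ) (τ : ℝ) :
    volume (box n ρ τ) = ENNReal.ofReal ((2 * ρ) ^ n * τ) := by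
  have hcube : volume {x : Spc n | ∀ i, |x i| ≤ ρ} = ENNReal.ofReal ((2 * ρ) ^ n) := by
    have hpre : {x : Spc n | ∀ i, |x i| ≤ ρ} =
        (MeasurableEquiv.toLp 2 (Fin n → ℝ)).symm ⁻¹' Icc (fun _ => -ρ) (fun _ => ρ) := by
      ext x
      simp [abs_le, Pi.le_def, forall_and]
    rw [hpre, (EuclideanSpace.volume_preserving_symm_measurableEquiv_toLp (Fin n)).measure_preimage
      measurableSet_Icc.nullMeasurableSet, Real.volume_Icc_pi]
    rw [Finset.prod_const, Finset.card_univ, Fintype.card_fin, ENNReal.ofReal_pow (by positivity)]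
    congr 2
    ring
  rw [box, Measure.volume_eq_prod, Measure.prod_prod, hcube, Real.volume_Ioc, sub_zero,
    ENNReal.ofReal_mul (by positivity)]


theorem GoodF.zero_nonneg {p : ℝ} {f : ℝ → ℝ} (hf : GoodF p f) : 0 ≤ f 0 := by
  by_contra! h
  obtain ⟨-, hconv, -, -, hpos⟩ := hf
  have h1 := hpos 1 one_pos
  have hd : 0 < f 1 - f 0 := by linarith
  set θ := -f 0 / (f 1 - f 0) with hθ
  have hθ0 : 0 < θ := div_pos (by linarith) hd
  have hθ1 : θ ≤ 1 := by rw [hθ, div_le_one hd]; linarith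
  have hc := hconv.2 (mem_Ici.2 le_rfl) (mem_Ici.2 zero_le_one) (sub_nonneg.2 hθ1) hθ0.le
    (by ring)
  simp only [smul_eq_mul, mul_zero, mul_one, zero_add] at hc
  have hz : (1 - θ) * f 0 + θ * f 1 = 0 := by
    rw [hθ]; field_simp; ring
  linarith [hpos θ hθ0]

theorem GoodF.nonneg {p : ℝ} {f : ℝ → ℝ} (hf : GoodF p f) {ζ : ℝ} (hζ : 0 ≤ ζ) : 0 ≤ f ζ :=
  hf.zero_nonneg.trans (hf.1 (mem_Ici.2 le_rfl) hζ hζ)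

theorem ConvexOn.le_add_mul {F : ℝ → ℝ} (hF : ConvexOn ℝ (Ici 0) F) (h0 : ∀ ζ, 0 ≤ ζ → 0 ≤ F ζ)
    {s : ℝ} (hs : 0 < s) (hFs : 0 < F s) (h2 : 2 * F 0 ≤ F s) {ζ : ℝ} (hζ : 0 ≤ ζ) :
    ζ ≤ s + 2 * s / F s * F ζ := by
  rcases le_or_gt ζ s with h | h
  · have : 0 ≤ 2 * s / F s * F ζ := mul_nonneg (by positivity) (h0 ζ hζ)
    linarith
  · have hζ0 : 0 < ζ := hs.trans h
    have hc := hF.2 (mem_Ici.2 le_rfl) (mem_Ici.2 hζ)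
      (show 0 ≤ 1 - s / ζ by rw [sub_nonneg, div_le_one hζ0]; exact h.le)
      (show 0 ≤ s / ζ by positivity) (by ring)
    simp only [smul_eq_mul, mul_zero, zero_add] at hc
    rw [div_mul_cancel₀ _ hζ0.ne'] at hc
    have h3 : F s ≤ F 0 + s / ζ * F ζ := by
      have : 0 ≤ s / ζ * F 0 := mul_nonneg (by positivity) (h0 0 le_rfl)
      linarith
    have h4 : F s ≤ 2 * (s / ζ * F ζ) := by linarith
    have h5 : ζ ≤ 2 * s / F s * F ζ := by
      rw [div_mul_eq_mul_div, le_div_iff₀ hFs]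
      calc ζ * F s ≤ ζ * (2 * (s / ζ * F ζ)) := by gcongr
        _ = 2 * s * F ζ := by field_simp
    linarith

theorem GoodF.le_add_mul {p : ℝ} {f : ℝ → ℝ} (hf : GoodF p f) {s : ℝ} (hs : 0 < s)
    (h2 : 2 * f 0 ≤ f s) {ζ : ℝ} (hζ : 0 ≤ ζ) : ζ ≤ s + 2 * s / f s * f ζ :=
  hf.2.1.le_add_mul (fun _ h => hf.nonneg h) hs (hf.2.2.2.2 s hs) h2 hζ

theorem GoodF.rpow_le_add_mul {p : ℝ} {f : ℝ → ℝ} (hp : 0 < p) (hf : GoodF p f) {s : ℝ}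
    (hs : 0 < s) (h2 : 2 * f 0 ≤ f s) {ζ : ℝ} (hζ : 0 ≤ ζ) :
    ζ ^ p ≤ s ^ p + 2 * s ^ p / f s * f ζ := by
  have hinv : ∀ x : ℝ, 0 ≤ x → (x ^ p) ^ (1 / p) = x := fun x hx => by
    rw [← rpow_mul hx, mul_one_div_cancel hp.ne', rpow_one]
  have h0 : (0 : ℝ) ^ (1 / p) = 0 := zero_rpow (one_div_pos.2 hp).ne'
  have := hf.2.2.2.1.le_add_mul (fun x h => hf.nonneg (rpow_nonneg h _)) (rpow_pos_of_pos hs p)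
    (by rw [hinv s hs.le]; exact hf.2.2.2.2 s hs) (by rw [hinv s hs.le, h0]; exact h2)
    (rpow_nonneg hζ p)
  simpa only [hinv s hs.le, hinv ζ hζ] using this

theorem summable_of_integrableOn_rpow_div {f : ℝ → ℝ} (hmono : MonotoneOn f (Ici 0))
    (hpos : ∀ ζ, 0 < ζ → 0 < f ζ) {q r : ℝ} (hr : 0 < r)
    (hint : IntegrableOn (fun ζ : ℝ => ζ ^ (q * r - 1) / f ζ ^ r) (Ioi 1)) (hq : 0 < q) :
    Summable fun i : ℕ => (((2 : ℝ) ^ i) ^ q / f (2 ^ i)) ^ r := by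
  rw [← summable_nat_add_iff 1]
  set g : ℝ → ℝ := fun ζ => ζ ^ (q * r - 1) / f ζ ^ r
  have hsub : (⋃ i : ℕ, Ioc ((2 : ℝ) ^ i) (2 ^ (i + 1))) ⊆ Ioi 1 :=
    iUnion_subset fun i x hx => lt_of_le_of_lt (one_le_pow₀ one_le_two) hx.1
  have hmono2 : Monotone fun i : ℕ => (2 : ℝ) ^ i := pow_right_mono₀ one_le_two
  have hsum : Summable fun i : ℕ => ∫ ζ in Ioc ((2 : ℝ) ^ i) (2 ^ (i + 1)), g ζ :=
    (hasSum_integral_iUnion (fun _ => measurableSet_Ioc) hmono2.pairwise_disjoint_on_Ioc_succ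
      (hint.mono_set hsub)).summable
  refine Summable.of_nonneg_of_le (fun i => ?_) (fun i => ?_) (hsum.mul_left (2 * 2 ^ (q * r)))
  · have := hpos (2 ^ (i + 1)) (by positivity)
    positivity
  set s : ℝ := 2 ^ i with hs
  have hs0 : 0 < s := by positivity
  have h2s : (2 : ℝ) ^ (i + 1) = 2 * s := by rw [hs, pow_succ]; ring
  rw [h2s]
  have hf2 := hpos (2 * s) (by positivity)
  have hlow : ∀ ζ ∈ Ioc s (2 * s), s ^ (q * r) / (2 * s) / f (2 * s) ^ r ≤ g ζ := by
    intro ζ hζ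
    have hζ0 : 0 < ζ := hs0.trans hζ.1
    have hfζ := hpos ζ hζ0
    have h1 : f ζ ≤ f (2 * s) := hmono (mem_Ici.2 hζ0.le) (mem_Ici.2 (by positivity)) hζ.2
    simp only [g]
    rw [rpow_sub_one hζ0.ne']
    have := hζ.1.le
    have := hζ.2
    gcongr
  have hIsub : Ioc s (2 * s) ⊆ Ioi 1 := by
    rw [← h2s]; exact (subset_iUnion (fun i : ℕ => Ioc ((2 : ℝ) ^ i) (2 ^ (i + 1))) i).trans hsub
  have hI := setIntegral_mono_on (integrableOn_const (by simp)) (hint.mono_set hIsub)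
    measurableSet_Ioc hlow
  rw [setIntegral_const, measureReal_def, Real.volume_Ioc, show 2 * s - s = s by ring,
    ENNReal.toReal_ofReal hs0.le, smul_eq_mul] at hI
  calc ((2 * s) ^ q / f (2 * s)) ^ r
      = 2 * 2 ^ (q * r) * (s * (s ^ (q * r) / (2 * s) / f (2 * s) ^ r)) := by
        rw [div_rpow (by positivity) hf2.le, ← rpow_mul (by positivity),
          mul_rpow two_pos.le hs0.le]
        field_simp
    _ ≤ _ := by gcongr

theorem tendsto_div_of_summable_rpow {x : ℕ → ℝ} (hx : ∀ i, 0 < x i) {r : ℝ} (hr : 0 < r)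
    (h : Summable fun i => x i ^ r) : Tendsto x atTop (nhds 0) := by
  have h1 := h.tendsto_atTop_zero.rpow_const (p := r⁻¹) (Or.inr (inv_pos.2 hr).le)
  rw [zero_rpow (inv_pos.2 hr).ne'] at h1
  refine h1.congr fun i => ?_
  rw [← rpow_mul (hx i).le, mul_inv_cancel₀ hr.ne', rpow_one]

theorem tendsto_atTop_of_summable {f : ℝ → ℝ} (hpos : ∀ ζ, 0 < ζ → 0 < f ζ) {r : ℝ} (hr : 0 < r)
    (h : Summable fun i : ℕ => ((2 : ℝ) ^ i / f (2 ^ i)) ^ r) :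
    Tendsto (fun i : ℕ => f (2 ^ i)) atTop atTop := by
  have h1 := tendsto_div_of_summable_rpow
    (fun i => div_pos (by positivity) (hpos (2 ^ i) (by positivity))) hr h
  refine tendsto_atTop_mono' _ ?_ (tendsto_pow_atTop_atTop_of_one_lt (one_lt_two : (1 : ℝ) < 2))
  filter_upwards [h1.eventually_le_const one_pos] with i hi
  rwa [div_le_one (hpos _ (by positivity))] at hi

/-- Keller–Osserman type iteration: a function on `[1, 2]` controlled at each point by its values
further to the right, with a superlinear gain encoded by `f`, is bounded at `1` independently of
its size at `2`. -/
theorem exists_bound_of_selfimproving {f : ℝ → ℝ} {p : ℝ}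
    (hpos : ∀ ζ, 0 < ζ → 0 < f ζ) {k m : ℕ} (hk : k ≠ 0) (hm : m ≠ 0)
    (hsk : Summable fun i : ℕ => ((2 : ℝ) ^ i / f (2 ^ i)) ^ (k : ℝ)⁻¹)
    (hsm : Summable fun i : ℕ => (((2 : ℝ) ^ i) ^ p / f (2 ^ i)) ^ (m : ℝ)⁻¹)
    {K : ℝ} (hK : 0 < K) :
    ∃ M : ℝ, ∀ e : ℝ → ℝ, (∀ σ, 1 ≤ σ → σ ≤ 2 → e σ ≤ e 2) →
      (∀ σ σ' s, 1 ≤ σ → σ < σ' → σ' ≤ 2 → 0 < s → 2 * f 0 ≤ f s →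
        e σ ≤ K * ((s + 2 * s / f s * e σ') / (σ' - σ) ^ k +
          (s ^ p + 2 * s ^ p / f s * e σ') / (σ' - σ) ^ m)) → e 1 ≤ M := by
  have hk0 : 0 < (k : ℝ)⁻¹ := inv_pos.2 (by positivity)
  have hm0 : 0 < (m : ℝ)⁻¹ := inv_pos.2 (by positivity)
  have hinf := tendsto_atTop_of_summable hpos hk0 hsk
  set L : ℝ := 6 * K * (2 + 2 ^ p) with hL
  have hL0 : 0 < L := by positivity
  set x : ℕ → ℝ := fun i => L * ((2 : ℝ) ^ i / f (2 ^ i)) with hx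
  set y : ℕ → ℝ := fun i => L * (((2 : ℝ) ^ i) ^ p / f (2 ^ i)) with hy
  have hfi : ∀ i : ℕ, 0 < f (2 ^ i) := fun i => hpos _ (by positivity)
  have hx0 : ∀ i, 0 < x i := fun i => by have := hfi i; positivity
  have hy0 : ∀ i, 0 < y i := fun i => by have := hfi i; positivity
  set δ : ℕ → ℝ := fun i => x i ^ (k : ℝ)⁻¹ + y i ^ (m : ℝ)⁻¹ with hδ
  have hδ0 : ∀ i, 0 < δ i := fun i => add_pos (rpow_pos_of_pos (hx0 i) _)
    (rpow_pos_of_pos (hy0 i) _)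
  have hδsum : Summable δ := by
    refine Summable.add ?_ ?_
    · refine (hsk.mul_left (L ^ (k : ℝ)⁻¹)).congr fun i => ?_
      rw [hx, mul_rpow hL0.le (div_nonneg (by positivity) (hfi i).le)]
    · refine (hsm.mul_left (L ^ (m : ℝ)⁻¹)).congr fun i => ?_
      rw [hy, mul_rpow hL0.le (div_nonneg (by positivity) (hfi i).le)]
  have hδk : ∀ i, x i ≤ δ i ^ k := fun i => by
    calc x i = (x i ^ (k : ℝ)⁻¹) ^ k := (rpow_inv_natCast_pow (hx0 i).le hk).symm
      _ ≤ δ i ^ k := by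
        have := rpow_nonneg (hy0 i).le (m : ℝ)⁻¹
        have := rpow_nonneg (hx0 i).le (k : ℝ)⁻¹
        gcongr
        simp only [hδ]; linarith
  have hδm : ∀ i, y i ≤ δ i ^ m := fun i => by
    calc y i = (y i ^ (m : ℝ)⁻¹) ^ m := (rpow_inv_natCast_pow (hy0 i).le hm).symm
      _ ≤ δ i ^ m := by
        have := rpow_nonneg (hy0 i).le (m : ℝ)⁻¹
        have := rpow_nonneg (hx0 i).le (k : ℝ)⁻¹
        gcongr
        simp only [hδ]; linarith
  have htail : ∀ᶠ N in atTop, ∑' j, δ (j + N) < 1 :=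
    (tendsto_sum_nat_add δ).eventually_lt_const one_pos
  have hbig : ∀ᶠ N in atTop, ∀ i ≥ N, 2 * f 0 ≤ f (2 ^ i) :=
    eventually_forall_ge_atTop.2 (hinf.eventually_ge_atTop (2 * f 0))
  obtain ⟨N, hN1, hN2⟩ := (htail.and hbig).exists
  refine ⟨f (2 ^ N), fun e hmono hself => ?_⟩
  by_contra! hlt
  have hsumN : Summable fun j => δ (j + N) := (summable_nat_add_iff N).2 hδsum
  set σ : ℕ → ℝ := fun i => 1 + ∑ j ∈ Finset.range i, δ (j + N) with hσ
  have hσ1 : ∀ i, 1 ≤ σ i := fun i => by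
    have : 0 ≤ ∑ j ∈ Finset.range i, δ (j + N) := Finset.sum_nonneg fun j _ => (hδ0 _).le
    simp only [hσ]; linarith
  have hσ2 : ∀ i, σ i ≤ 2 := fun i => by
    have := hsumN.sum_le_tsum (Finset.range i) fun j _ => (hδ0 _).le
    simp only [hσ]; linarith
  have hσs : ∀ i, σ (i + 1) - σ i = δ (i + N) := fun i => by
    simp only [hσ, Finset.sum_range_succ]; ring
  have hstep : ∀ i, f (2 ^ (i + N)) ≤ e (σ i) := by
    intro i
    induction i with
    | zero => simpa [hσ] using hlt.le
    | succ i ih =>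
      by_contra! hc
      set s : ℝ := 2 ^ (i + N) with hs
      have hs0 : 0 < s := by positivity
      have h2s : (2 : ℝ) ^ (i + 1 + N) = 2 * s := by
        rw [hs, add_right_comm, pow_succ]; ring
      rw [h2s] at hc
      have hf2 : 0 < f (2 * s) := hpos _ (by positivity)
      have hfs : 0 < f s := hpos _ hs0
      have h := hself (σ i) (σ (i + 1)) (2 * s) (hσ1 i) (by linarith [hσs i, hδ0 (i + N)])
        (hσ2 _) (by positivity) (by rw [← h2s]; exact hN2 _ (by omega))
      rw [hσs] at h
      have hspl : ∀ w : ℝ, 0 < w → w + 2 * w / f (2 * s) * e (σ (i + 1)) ≤ 3 * w := fun w hw => by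
        have : 2 * w / f (2 * s) * e (σ (i + 1)) ≤ 2 * w / f (2 * s) * f (2 * s) := by gcongr
        rw [div_mul_cancel₀ _ hf2.ne'] at this
        linarith
      have hb1 : (2 * s + 2 * (2 * s) / f (2 * s) * e (σ (i + 1))) / δ (i + N) ^ k ≤
          3 * (2 * s) / x (i + N) := by
        have := hspl (2 * s) (by positivity)
        have := hδk (i + N)
        have := hx0 (i + N)
        calc _ ≤ 3 * (2 * s) / δ (i + N) ^ k := by
              have := hδ0 (i + N); gcongr
          _ ≤ _ := by gcongr
      have hb2 : ((2 * s) ^ p + 2 * (2 * s) ^ p / f (2 * s) * e (σ (i + 1))) / δ (i + N) ^ m ≤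
          3 * (2 * s) ^ p / y (i + N) := by
        have := hspl ((2 * s) ^ p) (by positivity)
        have := hδm (i + N)
        have := hy0 (i + N)
        calc _ ≤ 3 * (2 * s) ^ p / δ (i + N) ^ m := by
              have := hδ0 (i + N); gcongr
          _ ≤ _ := by gcongr
      have hfin : K * (3 * (2 * s) / x (i + N) + 3 * (2 * s) ^ p / y (i + N)) = f s / 2 := by
        simp only [hx, hy, ← hs, hL]
        rw [mul_rpow two_pos.le hs0.le]
        have : (0 : ℝ) < 2 ^ p := by positivity
        have : 0 < s ^ p := by positivity
        field_simp
        ring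
      have : e (σ i) ≤ f s / 2 := by
        rw [← hfin]
        refine h.trans ?_
        gcongr
      linarith
  obtain ⟨i, hi⟩ := ((hinf.comp (tendsto_add_atTop_nat N)).eventually_gt_atTop (e 2)).exists
  exact absurd hi (not_lt.2 ((hstep i).trans (hmono _ (hσ1 i) (hσ2 i))))


theorem abs_tensorFun_le_indicator {n : ℕ} {g : Fin n → ℝ → ℝ} {h : ℝ → ℝ} {B : Fin n → ℝ}
    {D b d : ℝ} (hg : ∀ i x, |g i x| ≤ B i) (hg0 : ∀ i x, b < |x| → g i x = 0)
    (hh : ∀ t, |h t| ≤ D) (hh0 : ∀ t, d < |t| → h t = 0) {z : Spc n × ℝ} (hz : z ∈ halfSp n) :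
    |tensorFun g h z| ≤ (box n b d).indicator (fun _ => (∏ i, B i) * D) z := by
  by_cases hzb : z ∈ box n b d
  · rw [indicator_of_mem hzb, tensorFun, abs_mul, Finset.abs_prod]
    exact mul_le_mul (Finset.prod_le_prod (fun _ _ => abs_nonneg _) fun i _ => hg i _) (hh _)
      (abs_nonneg _) (Finset.prod_nonneg fun i _ => (abs_nonneg _).trans (hg i 0))
  · rw [indicator_of_notMem hzb]
    have hz0 : 0 < z.2 := hz
    by_cases hx : ∀ i, |z.1 i| ≤ b
    · have ht : d < |z.2| := by
        by_contra! ht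
        exact hzb ⟨hx, hz0, (le_abs_self _).trans ht⟩
      simp [tensorFun, hh0 _ ht]
    · push Not at hx
      obtain ⟨i, hi⟩ := hx
      have : ∏ i, g i (z.1 i) = 0 := Finset.prod_eq_zero (Finset.mem_univ i) (hg0 i _ hi)
      simp [tensorFun, this]

theorem setIntegral_halfSp_indicator_box {n : ℕ} (b d : ℝ) (g : Spc n × ℝ → ℝ) :
    ∫ z in halfSp n, (box n b d).indicator g z = ∫ z in box n b d, g z := by
  rw [setIntegral_indicator (measurableSet_box n b d),
    inter_eq_self_of_subset_right (box_subset_halfSp n b d)]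

theorem integrable_halfSp_indicator_box {n : ℕ} {b d : ℝ} {g : Spc n × ℝ → ℝ}
    (hg : IntegrableOn g (box n b d)) :
    Integrable ((box n b d).indicator g) (volume.restrict (halfSp n)) :=
  (hg.integrable_indicator (measurableSet_box n b d)).integrableOn

theorem integrableOn_box_of_cyl {n : ℕ} {g : Spc n × ℝ → ℝ}
    (hg : ∀ r : ℝ, 0 < r → IntegrableOn g (cyl n r 1)) (ρ τ : ℝ) : IntegrableOn g (box n ρ τ) := by
  obtain ⟨r, hr, hsub⟩ := box_subset_cyl n ρ τ
  exact (hg r hr).mono_set hsub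

/-- The estimate obtained by testing the differential inequality with a product of cutoffs. -/
theorem IsGlobalWeakSol.energy_estimate {n k m : ℕ} (hk : 1 ≤ k) {A p : ℝ} (hA : 0 < A)
    {a : (Fin n → ℕ) → Spc n × ℝ → ℝ → ℝ} (ha : GoodCoeffs n m A p a)
    {f : ℝ → ℝ} (hf : GoodF p f) {u0 : ℕ → Spc n → ℝ}
    (hu0nn : ∀ᵐ x ∂(volume : Measure (Spc n)), 0 ≤ u0 (k - 1) x)
    {u : Spc n × ℝ → ℝ} (hu : IsGlobalWeakSol n k m p a f u0 u) :
    ∃ K : ℝ, 0 < K ∧ ∀ r R c d : ℝ, 0 < r → r < R → 0 < c → c < d →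
      ∫ z in box n r c, f |u z| ≤
        K * ((∫ z in box n R d, |u z|) / (d - c) ^ k +
          (∫ z in box n R d, |u z| ^ p) / (R - r) ^ m) := by
  obtain ⟨C, hC0, hC⟩ := exists_isCutoff
  obtain ⟨hu1, hup, hfu, hweak⟩ := hu
  set S : ℝ := ∑ α ∈ mIdx n m, A * ∏ i, C (α i) with hS
  have hS0 : 0 ≤ S := Finset.sum_nonneg fun α _ =>
    mul_nonneg hA.le (Finset.prod_nonneg fun i _ => (hC0 _).le)
  refine ⟨C k + S, add_pos_of_pos_of_nonneg (hC0 k) hS0, fun r R c d hr hrR hc hcd => ?_⟩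
  have hRr : 0 < R - r := sub_pos.2 hrR
  have hdc : 0 < d - c := sub_pos.2 hcd
  obtain ⟨η, hη⟩ := hC r R hr hrR
  obtain ⟨θ, hθ⟩ := hC c d hc hcd
  have hηabs : ∀ x, |η x| ≤ 1 := fun x => abs_le.2 ⟨by linarith [hη.nonneg x], hη.le_one x⟩
  have hθabs : ∀ x, |θ x| ≤ 1 := fun x => abs_le.2 ⟨by linarith [hθ.nonneg x], hθ.le_one x⟩
  set φ : Spc n × ℝ → ℝ := tensorFun (fun _ => η) θ with hφ
  have hφsmooth : ContDiff ℝ (⊤ : ℕ∞) φ := contDiff_tensorFun (fun _ => hη.contDiff) hθ.contDiff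
  have hφ0 : ∀ z, 0 ≤ φ z := fun z =>
    mul_nonneg (Finset.prod_nonneg fun i _ => hη.nonneg _) (hθ.nonneg _)
  have hφcomp : HasCompactSupport φ := by
    refine HasCompactSupport.intro
      ((isCompact_closedBall (0 : Spc n) (n * R)).prod (isCompact_Icc (a := -d) (b := d))) ?_
    intro z hz
    by_contra hne
    refine hz ⟨?_, ?_⟩
    · rw [mem_closedBall_zero_iff]
      refine EuclideanSpace.norm_le_of_abs_le (hr.trans hrR).le fun i => ?_
      by_contra! hi
      exact hne (by rw [hφ, tensorFun, Finset.prod_eq_zero (Finset.mem_univ i)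
        (hη.eq_zero _ hi.le), zero_mul])
    · rw [mem_Icc, ← abs_le]
      by_contra! hi
      exact hne (by rw [hφ, tensorFun, hθ.eq_zero _ hi.le, mul_zero])
  have hw := hweak φ hφsmooth hφcomp hφ0
  have hinit : 0 ≤ ∫ x : Spc n, ∑ i ∈ Finset.range k,
      (-1 : ℝ) ^ i * u0 (k - 1 - i) x * (tDeriv n)^[i] φ (x, 0) := by
    refine integral_nonneg_of_ae ?_
    filter_upwards [hu0nn] with x hx
    rw [Pi.zero_apply, Finset.sum_eq_single_of_mem 0 (Finset.mem_range.2 hk)]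
    · simpa using mul_nonneg hx (hφ0 (x, 0))
    · intro i _ hi
      rw [tDeriv_iterate_tensorFun, tensorFun, hθ.iteratedDeriv_zero hc hi]
      simp
  have htime : |∫ z in halfSp n, (-1 : ℝ) ^ k * u z * (tDeriv n)^[k] φ z| ≤
      C k * ((∫ z in box n R d, |u z|) / (d - c) ^ k) := by
    have hint : IntegrableOn (fun z => C k / (d - c) ^ k * |u z|) (box n R d) :=
      (integrableOn_box_of_cyl hu1 R d).abs.const_mul _
    rw [← Real.norm_eq_abs]
    refine (norm_integral_le_of_norm_le (integrable_halfSp_indicator_box hint) ?_).trans_eq ?_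
    · refine ae_restrict_of_forall_mem (measurableSet_halfSp n) fun z hz => ?_
      have hb := abs_tensorFun_le_indicator (b := R) (d := d) (B := fun _ : Fin n => (1 : ℝ))
        (fun _ => hηabs) (fun _ x hx => hη.eq_zero x hx.le) (hθ.bound k)
        (fun t ht => hθ.iteratedDeriv_eq_zero k ht) hz
      rw [tDeriv_iterate_tensorFun, norm_mul, norm_mul, norm_pow, norm_neg, norm_one, one_pow,
        one_mul, Real.norm_eq_abs, Real.norm_eq_abs]
      refine (mul_le_mul_of_nonneg_left hb (abs_nonneg (u z))).trans_eq ?_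
      by_cases hzb : z ∈ box n R d
      · simp [hzb, mul_comm]
      · simp [hzb]
    · rw [setIntegral_halfSp_indicator_box, integral_const_mul]
      ring
  have hspace : |∫ z in halfSp n, ∑ α ∈ mIdx n m,
      (-1 : ℝ) ^ m * a α z (u z) * mDeriv n α φ z| ≤
      S * ((∫ z in box n R d, |u z| ^ p) / (R - r) ^ m) := by
    have hint : IntegrableOn (fun z => S / (R - r) ^ m * |u z| ^ p) (box n R d) :=
      (integrableOn_box_of_cyl hup R d).const_mul _
    rw [← Real.norm_eq_abs]
    refine (norm_integral_le_of_norm_le (integrable_halfSp_indicator_box hint) ?_).trans_eq ?_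
    · have hae : ∀ᵐ z ∂(volume.restrict (halfSp n)), ∀ α ∈ mIdx n m,
          ∀ ζ : ℝ, |a α z ζ| ≤ A * |ζ| ^ p :=
        (Finset.eventually_all _).2 fun α hα => (ha α hα).2.2
      filter_upwards [hae, ae_restrict_mem (measurableSet_halfSp n)] with z hza hz
      refine (norm_sum_le _ _).trans ?_
      have hterm : ∀ α ∈ mIdx n m, ‖(-1 : ℝ) ^ m * a α z (u z) * mDeriv n α φ z‖ ≤
          (A * |u z| ^ p) *
            (box n R d).indicator (fun _ => (∏ i, C (α i)) / (R - r) ^ m) z := by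
        intro α hα
        have hb := abs_tensorFun_le_indicator (b := R) (d := d)
          (B := fun i => C (α i) / (R - r) ^ (α i)) (fun i => hη.bound (α i))
          (fun i x hx => hη.iteratedDeriv_eq_zero (α i) hx) hθabs
          (fun t ht => hθ.eq_zero t ht.le) hz
        rw [Finset.prod_div_distrib, Finset.prod_pow_eq_pow_sum,
          (Finset.mem_filter.1 hα).2, mul_one] at hb
        rw [hφ, mDeriv_tensorFun, norm_mul, norm_mul, norm_pow, norm_neg, norm_one, one_pow,
          one_mul]
        exact mul_le_mul (hza α hα (u z)) hb (abs_nonneg _) (by positivity)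
      refine (Finset.sum_le_sum hterm).trans_eq ?_
      by_cases hzb : z ∈ box n R d
      · simp only [indicator_of_mem hzb, hS, Finset.sum_div, Finset.sum_mul]
        exact Finset.sum_congr rfl fun α _ => by ring
      · simp [hzb]
    · rw [setIntegral_halfSp_indicator_box, integral_const_mul]
      ring
  have hlow : ∫ z in box n r c, f |u z| ≤ ∫ z in halfSp n, f |u z| * φ z := by
    have hF := integrable_halfSp_indicator_box (integrableOn_box_of_cyl hfu R d)
    have hFφ : Integrable (fun z => f |u z| * φ z) (volume.restrict (halfSp n)) := by
      have hbound : ∀ᵐ z ∂(volume.restrict (halfSp n)), ‖φ z‖ ≤ 1 := by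
        refine ae_of_all _ fun z => ?_
        rw [Real.norm_eq_abs, abs_of_nonneg (hφ0 z)]
        exact mul_le_one₀ (Finset.prod_le_one (fun i _ => hη.nonneg _) fun i _ => hη.le_one _)
          (hθ.nonneg _) (hθ.le_one _)
      refine (hF.mul_bdd hφsmooth.continuous.aestronglyMeasurable hbound).congr ?_
      refine ae_restrict_of_forall_mem (measurableSet_halfSp n) fun z hz => ?_
      by_cases hzb : z ∈ box n R d
      · simp [hzb]
      · have hb := abs_tensorFun_le_indicator (b := R) (d := d) (B := fun _ : Fin n => (1 : ℝ))
          (fun _ => hηabs) (fun _ x hx => hη.eq_zero x hx.le) hθabs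
          (fun t ht => hθ.eq_zero t ht.le) hz
        rw [indicator_of_notMem hzb] at hb
        have : φ z = 0 := abs_nonpos_iff.1 hb
        simp [this]
    rw [← setIntegral_halfSp_indicator_box]
    refine integral_mono (integrable_halfSp_indicator_box (integrableOn_box_of_cyl hfu r c))
      hFφ fun z => ?_
    by_cases hz : z ∈ box n r c
    · have hφ1 : φ z = 1 := by
        rw [hφ, tensorFun, hθ.eq_one _ (by rw [abs_of_pos hz.2.1]; exact hz.2.2),
          Finset.prod_eq_one fun i _ => hη.eq_one _ (hz.1 i), one_mul]
      simp [hz, hφ1]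
    · simp only [indicator_of_notMem hz]
      exact mul_nonneg (hf.nonneg (abs_nonneg _)) (hφ0 z)
  have hU : 0 ≤ (∫ z in box n R d, |u z|) / (d - c) ^ k :=
    div_nonneg (integral_nonneg fun _ => abs_nonneg _) (by positivity)
  have hUp : 0 ≤ (∫ z in box n R d, |u z| ^ p) / (R - r) ^ m :=
    div_nonneg (integral_nonneg fun _ => by positivity) (by positivity)
  have h1 := (abs_le.1 htime).2
  have h2 := (abs_le.1 hspace).1
  have h3 := mul_nonneg (hC0 k).le hUp
  have h4 := mul_nonneg hS0 hU
  calc _ ≤ C k * ((∫ z in box n R d, |u z|) / (d - c) ^ k) +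
        S * ((∫ z in box n R d, |u z| ^ p) / (R - r) ^ m) := by linarith
    _ ≤ _ := by linarith


theorem IsGlobalWeakSol.scaled_estimate {n k m : ℕ} (hk : 1 ≤ k) {A p : ℝ} (hA : 0 < A)
    (hp : 0 < p) {a : (Fin n → ℕ) → Spc n × ℝ → ℝ → ℝ} (ha : GoodCoeffs n m A p a)
    {f : ℝ → ℝ} (hf : GoodF p f) {u0 : ℕ → Spc n → ℝ}
    (hu0nn : ∀ᵐ x ∂(volume : Measure (Spc n)), 0 ≤ u0 (k - 1) x)
    {u : Spc n × ℝ → ℝ} (hu : IsGlobalWeakSol n k m p a f u0 u) :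
    ∃ K : ℝ, 0 < K ∧ ∀ t σ σ' s : ℝ, 1 ≤ t → 1 ≤ σ → σ < σ' → σ' ≤ 2 → 0 < s → 2 * f 0 ≤ f s →
      ∫ z in box n (σ * t ^ k) (σ * t ^ m), f |u z| ≤ K / t ^ (k * m) *
        ((s * (2 ^ (2 * n + 1) * t ^ (k * n + m)) +
          2 * s / f s * ∫ z in box n (σ' * t ^ k) (σ' * t ^ m), f |u z|) / (σ' - σ) ^ k +
        (s ^ p * (2 ^ (2 * n + 1) * t ^ (k * n + m)) +
          2 * s ^ p / f s * ∫ z in box n (σ' * t ^ k) (σ' * t ^ m), f |u z|) / (σ' - σ) ^ m) := by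
  obtain ⟨K, hK0, hK⟩ := hu.energy_estimate hk hA ha hf hu0nn
  obtain ⟨hu1, hup, hfu, -⟩ := hu
  refine ⟨K, hK0, fun t σ σ' s ht hσ hσσ' hσ' hs h2 => ?_⟩
  have ht0 : 0 < t := one_pos.trans_le ht
  have hσ0 : 0 < σ := one_pos.trans_le hσ
  have hd : 0 < σ' - σ := sub_pos.2 hσσ'
  have h := hK (σ * t ^ k) (σ' * t ^ k) (σ * t ^ m) (σ' * t ^ m) (by positivity) (by gcongr)
    (by positivity) (by gcongr)
  set Q := box n (σ' * t ^ k) (σ' * t ^ m) with hQ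
  have hvol : (volume Q).toReal ≤ 2 ^ (2 * n + 1) * t ^ (k * n + m) := by
    have hσ'0 : 0 < σ' := hσ0.trans hσσ'
    rw [hQ, volume_box n (by positivity), ENNReal.toReal_ofReal (by positivity)]
    calc (2 * (σ' * t ^ k)) ^ n * (σ' * t ^ m) ≤ (2 * (2 * t ^ k)) ^ n * (2 * t ^ m) := by gcongr
      _ = (2 * 2) ^ n * 2 * ((t ^ k) ^ n * t ^ m) := by rw [mul_pow, mul_pow, mul_pow]; ring
      _ = _ := by rw [pow_succ _ (2 * n), pow_mul 2, pow_add t, pow_mul t]; norm_num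
  have hQfin : volume Q ≠ ⊤ := by
    rw [hQ, volume_box n (by have := hσ0.trans hσσ'; positivity)]
    exact ENNReal.ofReal_ne_top
  have hsplit : ∀ (v : Spc n × ℝ → ℝ) (w c : ℝ), 0 ≤ w → IntegrableOn v Q →
      (∀ z, v z ≤ w + c * f |u z|) →
      ∫ z in Q, v z ≤ w * (2 ^ (2 * n + 1) * t ^ (k * n + m)) + c * ∫ z in Q, f |u z| := by
    intro v w c hw hv hle
    have hI : IntegrableOn (fun _ : Spc n × ℝ => w) Q := integrableOn_const hQfin
    have hJ : IntegrableOn (fun z => c * f |u z|) Q :=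
      (integrableOn_box_of_cyl hfu _ _).const_mul c
    calc ∫ z in Q, v z ≤ ∫ z in Q, (w + c * f |u z|) := integral_mono hv (hI.add hJ) hle
      _ = w * (volume Q).toReal + c * ∫ z in Q, f |u z| := by
        rw [integral_add hI hJ, setIntegral_const, integral_const_mul, smul_eq_mul,
          measureReal_def, mul_comm]
      _ ≤ _ := by gcongr
  have hs1 := hsplit (fun z => |u z|) s _ hs.le (integrableOn_box_of_cyl hu1 _ _).abs
    fun z => hf.le_add_mul hs h2 (abs_nonneg _)
  have hs2 := hsplit (fun z => |u z| ^ p) (s ^ p) _ (by positivity)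
    (integrableOn_box_of_cyl hup _ _) fun z => hf.rpow_le_add_mul hp hs h2 (abs_nonneg _)
  rw [← sub_mul, ← sub_mul, mul_pow, mul_pow, ← pow_mul, ← pow_mul, mul_comm m k] at h
  refine h.trans ?_
  rw [← div_div, ← div_div, ← add_div, mul_div_assoc', div_mul_eq_mul_div]
  gcongr

theorem exists_energy_bound {f : ℝ → ℝ} {p : ℝ} (hp : 0 < p) (hpos : ∀ ζ, 0 < ζ → 0 < f ζ) {k m q : ℕ}
    (hk : k ≠ 0) (hm : m ≠ 0) (hq : q ≤ k * m)
    (hsk : Summable fun i : ℕ => ((2 : ℝ) ^ i / f (2 ^ i)) ^ (k : ℝ)⁻¹)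
    (hsm : Summable fun i : ℕ => (((2 : ℝ) ^ i) ^ p / f (2 ^ i)) ^ (m : ℝ)⁻¹)
    {G : ℝ → ℝ → ℝ} (hG0 : ∀ ρ τ, 0 ≤ G ρ τ)
    (hGmono : ∀ ρ ρ' τ τ', ρ ≤ ρ' → τ ≤ τ' → G ρ τ ≤ G ρ' τ')
    {K W : ℝ} (hK : 0 < K) (hW : 0 < W)
    (hest : ∀ t σ σ' s : ℝ, 1 ≤ t → 1 ≤ σ → σ < σ' → σ' ≤ 2 → 0 < s → 2 * f 0 ≤ f s →
      G (σ * t ^ k) (σ * t ^ m) ≤ K / t ^ (k * m) *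
        ((s * (W * t ^ q) + 2 * s / f s * G (σ' * t ^ k) (σ' * t ^ m)) / (σ' - σ) ^ k +
        (s ^ p * (W * t ^ q) + 2 * s ^ p / f s * G (σ' * t ^ k) (σ' * t ^ m)) / (σ' - σ) ^ m)) :
    (∃ B, ∀ t, 1 ≤ t → G (t ^ k) (t ^ m) ≤ B) ∧
      (f 0 = 0 → ∀ t, 1 ≤ t → G (t ^ k) (t ^ m) ≤ 0) := by
  obtain ⟨M, hM⟩ := exists_bound_of_selfimproving (p := p) hpos hk hm hsk hsm hK
  have hmean : ∀ t, 1 ≤ t → G (t ^ k) (t ^ m) ≤ max M 0 * (W * t ^ q) := by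
    intro t ht
    have ht0 : 0 < t := one_pos.trans_le ht
    have hV : 0 < W * t ^ q := by positivity
    have := hM (fun σ => G (σ * t ^ k) (σ * t ^ m) / (W * t ^ q)) ?_ ?_
    · simp only [one_mul] at this
      rw [div_le_iff₀ hV] at this
      exact this.trans (by gcongr; exact le_max_left _ _)
    · intro σ _ h2
      gcongr
      exact hGmono _ _ _ _ (by gcongr) (by gcongr)
    · intro σ σ' s h1 h12 h2 hs hfs
      have hd : 0 < σ' - σ := sub_pos.2 h12
      have hf := hpos s hs
      have hg := hG0 (σ' * t ^ k) (σ' * t ^ m)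
      rw [div_le_iff₀ hV]
      refine (hest t σ σ' s ht h1 h12 h2 hs hfs).trans ?_
      calc _ ≤ K * ((s * (W * t ^ q) + 2 * s / f s * G (σ' * t ^ k) (σ' * t ^ m)) / (σ' - σ) ^ k +
            (s ^ p * (W * t ^ q) + 2 * s ^ p / f s * G (σ' * t ^ k) (σ' * t ^ m)) /
              (σ' - σ) ^ m) := by
            gcongr
            exact div_le_self hK.le (one_le_pow₀ ht)
        _ = _ := by field_simp
  have hdouble : ∀ t, 1 ≤ t → G (2 * t ^ k) (2 * t ^ m) ≤ G ((2 * t) ^ k) ((2 * t) ^ m) := by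
    intro t ht
    have ht0 : 0 < t := one_pos.trans_le ht
    rw [mul_pow, mul_pow]
    refine hGmono _ _ _ _ ?_ ?_
    · gcongr; exact le_self_pow₀ one_le_two hk
    · gcongr; exact le_self_pow₀ one_le_two hm
  have hratio : ∀ t : ℝ, 1 ≤ t → t ^ q / t ^ (k * m) ≤ 1 := fun t ht =>
    div_le_one_of_le₀ (pow_le_pow_right₀ ht hq) (by positivity)
  have hest' : ∀ t s, 1 ≤ t → 0 < s → 2 * f 0 ≤ f s → G (t ^ k) (t ^ m) ≤
      K * (s + s ^ p) * W +
        K * (2 * (s + s ^ p) / f s) * (G (2 * t ^ k) (2 * t ^ m) / t ^ (k * m)) := by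
    intro t s ht hs hfs
    have ht0 : 0 < t := one_pos.trans_le ht
    have h := hest t 1 2 s ht le_rfl one_lt_two le_rfl hs hfs
    norm_num at h
    calc G (t ^ k) (t ^ m) ≤ _ := h
      _ = K * (s + s ^ p) * W * (t ^ q / t ^ (k * m)) +
        K * (2 * (s + s ^ p) / f s) * (G (2 * t ^ k) (2 * t ^ m) / t ^ (k * m)) := by ring
      _ ≤ K * (s + s ^ p) * W * 1 +
        K * (2 * (s + s ^ p) / f s) * (G (2 * t ^ k) (2 * t ^ m) / t ^ (k * m)) := by
        gcongr
        exact hratio t ht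
      _ = _ := by rw [mul_one]
  have hbdd : ∃ B, ∀ t, 1 ≤ t → G (t ^ k) (t ^ m) ≤ B := by
    obtain ⟨i, hi⟩ := ((tendsto_atTop_of_summable hpos (inv_pos.2 (by positivity)) hsk
      ).eventually_ge_atTop (2 * f 0)).exists
    set s : ℝ := 2 ^ i
    have hs : 0 < s := by positivity
    have hfs := hpos s hs
    refine ⟨K * (s + s ^ p) * W + K * (2 * (s + s ^ p) / f s) * (max M 0 * (W * 2 ^ q)),
      fun t ht => (hest' t s ht hs hi).trans ?_⟩
    have ht0 : 0 < t := one_pos.trans_le ht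
    gcongr
    rw [div_le_iff₀ (by positivity)]
    calc G (2 * t ^ k) (2 * t ^ m) ≤ max M 0 * (W * (2 * t) ^ q) :=
          (hdouble t ht).trans (hmean _ (by linarith))
      _ = max M 0 * (W * 2 ^ q) * t ^ q := by rw [mul_pow]; ring
      _ ≤ _ := by gcongr
  refine ⟨hbdd, fun hf0 t ht => ?_⟩
  obtain ⟨B, hB⟩ := hbdd
  have ht0 : 0 < t := one_pos.trans_le ht
  have hsmall : ∀ s, 0 < s → G (t ^ k) (t ^ m) ≤ K * (s + s ^ p) * W := by
    intro s hs
    have hfs := hpos s hs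
    have hlim : Tendsto (fun T : ℝ => K * (s + s ^ p) * W +
        K * (2 * (s + s ^ p) / f s) * (B / T ^ (k * m))) atTop
        (nhds (K * (s + s ^ p) * W + K * (2 * (s + s ^ p) / f s) * 0)) :=
      ((tendsto_const_nhds.div_atTop (tendsto_pow_atTop (mul_ne_zero hk hm))).const_mul
        _).const_add _
    rw [mul_zero, add_zero] at hlim
    refine ge_of_tendsto hlim ?_
    filter_upwards [eventually_ge_atTop t] with T hT
    have hT1 := ht.trans hT
    have hT0 : 0 < T := one_pos.trans_le hT1
    have hBT := (hdouble T hT1).trans (hB (2 * T) (by linarith))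
    calc G (t ^ k) (t ^ m) ≤ G (T ^ k) (T ^ m) := hGmono _ _ _ _ (by gcongr) (by gcongr)
      _ ≤ _ := hest' T s hT1 hs (by rw [hf0, mul_zero]; exact hfs.le)
      _ ≤ _ := by gcongr
  have hlim : Tendsto (fun s : ℝ => K * (s + s ^ p) * W) (nhdsWithin 0 (Ioi 0))
      (nhds (K * (0 + 0 ^ p) * W)) :=
    (((continuous_id.add (continuous_rpow_const hp.le)).const_mul K).mul_const
      W).continuousAt.tendsto.mono_left nhdsWithin_le_nhds
  rw [zero_rpow hp.ne', add_zero, mul_zero, zero_mul] at hlim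
  exact ge_of_tendsto hlim (eventually_mem_nhdsWithin.mono fun s hs => hsmall s hs)

/-- **Theorem 2.0.** If `n ≤ m (1 - 1/k)` and conditions (1.4), (1.5) hold, then any
global weak solution of problem (1.1i), (1.1c) is trivial. -/
theorem blowup_subcritical_dimension
    (n k m : ℕ) (hn : 1 ≤ n) (hk : 1 ≤ k) (hm : 1 ≤ m)
    (A p : ℝ) (hA : 0 < A) (hp : 0 < p)
    (a : (Fin n → ℕ) → Spc n × ℝ → ℝ → ℝ) (ha : GoodCoeffs n m A p a)
    (f : ℝ → ℝ) (hf : GoodF p f)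
    (u0 : ℕ → Spc n → ℝ) (hu0 : ∀ i < k, L1locInit n (u0 i))
    (hu0nn : ∀ᵐ x ∂(volume : Measure (Spc n)), 0 ≤ u0 (k - 1) x)
    (h14 : Cond14 k f) (h15 : Cond15 m p f)
    (hdim : (n : ℝ) ≤ (m : ℝ) * (1 - 1 / (k : ℝ)))
    (u : Spc n × ℝ → ℝ) (hu : IsGlobalWeakSol n k m p a f u0 u) :
    TrivialSol n u := by
  have hk0 : (0 : ℝ) < k := by exact_mod_cast hk
  have hm0 : (0 : ℝ) < m := by exact_mod_cast hm
  have hpos := hf.2.2.2.2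
  have hq : k * n + m ≤ k * m := by
    have : (k : ℝ) * n + m ≤ k * m := by
      have h := mul_le_mul_of_nonneg_left hdim hk0.le
      have e : (k : ℝ) * (m * (1 - 1 / k)) = k * m - m := by field_simp
      linarith
    exact_mod_cast this
  have hsk : Summable fun i : ℕ => ((2 : ℝ) ^ i / f (2 ^ i)) ^ (k : ℝ)⁻¹ := by
    simpa only [rpow_one] using summable_of_integrableOn_rpow_div (q := 1) hf.1 hpos
      (inv_pos.2 hk0) (by rw [one_mul]; exact h14) one_pos
  have hsm : Summable fun i : ℕ => (((2 : ℝ) ^ i) ^ p / f (2 ^ i)) ^ (m : ℝ)⁻¹ :=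
    summable_of_integrableOn_rpow_div hf.1 hpos (inv_pos.2 hm0)
      (by rw [← div_eq_mul_inv]; exact h15) hp
  obtain ⟨K, hK0, hK⟩ := hu.scaled_estimate hk hA hp ha hf hu0nn
  obtain ⟨-, -, hfu, -⟩ := hu
  have hfint := integrableOn_box_of_cyl hfu
  have hf0 : ∀ z, 0 ≤ f |u z| := fun z => hf.nonneg (abs_nonneg _)
  obtain ⟨⟨B, hB⟩, hzero⟩ := exists_energy_bound hp hpos (by omega) (by omega) hq hsk hsm
    (G := fun ρ τ => ∫ z in box n ρ τ, f |u z|) (fun ρ τ => integral_nonneg hf0)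
    (fun ρ ρ' τ τ' hρ hτ => setIntegral_mono_set (hfint ρ' τ') (ae_of_all _ hf0)
      (box_mono n hρ hτ).eventuallyLE) hK0 (W := 2 ^ (2 * n + 1)) (by positivity) hK
  have hf00 : f 0 = 0 := by
    by_contra hne
    have h0 : 0 < f 0 := lt_of_le_of_ne hf.zero_nonneg (Ne.symm hne)
    obtain ⟨t, ht1, htB⟩ :=
      ((eventually_ge_atTop 1).and (eventually_gt_atTop (B / f 0))).exists
    have ht0 : 0 < t := one_pos.trans_le ht1
    have hvol := volume_box n (show 0 ≤ t ^ k by positivity) (t ^ m)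
    have h := setIntegral_mono_on (integrableOn_const (by rw [hvol]; exact ENNReal.ofReal_ne_top))
      (hfint (t ^ k) (t ^ m)) (measurableSet_box n _ _)
      (fun z _ => hf.1 (mem_Ici.2 le_rfl) (mem_Ici.2 (abs_nonneg (u z))) (abs_nonneg _))
    rw [setIntegral_const, measureReal_def, hvol, ENNReal.toReal_ofReal (by positivity),
      smul_eq_mul] at h
    have hge : t ≤ (2 * t ^ k) ^ n * t ^ m := by
      have h1 : 1 ≤ (2 * t ^ k) ^ n := one_le_pow₀ (by linarith [one_le_pow₀ (n := k) ht1])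
      have h2 : t ≤ t ^ m := le_self_pow₀ ht1 (by omega)
      nlinarith
    have h3 := mul_le_mul_of_nonneg_right hge h0.le
    rw [div_lt_iff₀ h0] at htB
    linarith [hB t ht1]
  have hbox : ∀ N : ℕ, ∀ᵐ z ∂(volume.restrict
      (box n (((N : ℝ) + 1) ^ k) (((N : ℝ) + 1) ^ m))), u z = 0 := by
    intro N
    have hN : (1 : ℝ) ≤ N + 1 := by linarith [Nat.cast_nonneg (α := ℝ) N]
    have hint := hfint (((N : ℝ) + 1) ^ k) (((N : ℝ) + 1) ^ m)
    have h := (integral_eq_zero_iff_of_nonneg hf0 hint).1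
      (le_antisymm (hzero hf00 _ hN) (integral_nonneg hf0))
    filter_upwards [h] with z hz
    by_contra hne
    exact (hpos _ (abs_pos.2 hne)).ne' hz
  refine ae_restrict_of_ae_restrict_of_subset (t := ⋃ N : ℕ,
    box n (((N : ℝ) + 1) ^ k) (((N : ℝ) + 1) ^ m)) ?_ ((ae_restrict_iUnion_iff _ _).2 hbox)
  intro z hz
  obtain ⟨N, hN⟩ := exists_nat_ge (max ‖z.1‖ z.2)
  have hN1 : (1 : ℝ) ≤ N + 1 := by linarith [Nat.cast_nonneg (α := ℝ) N]
  have hk1 : (N : ℝ) + 1 ≤ (N + 1) ^ k := le_self_pow₀ hN1 (by omega)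
  have hm1 : (N : ℝ) + 1 ≤ (N + 1) ^ m := le_self_pow₀ hN1 (by omega)
  refine mem_iUnion.2 ⟨N, fun i => ?_, hz, ?_⟩
  · have := (PiLp.norm_apply_le z.1 i).trans ((le_max_left _ z.2).trans hN)
    rw [Real.norm_eq_abs] at this
    linarith
  · linarith [(le_max_right ‖z.1‖ _).trans hN]
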